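/- arXiv:math/0607518 — 2 statements merged into one kernel-verified Lean document; each statement's English description precedes it below -/
import Mathlib

section
/- (Proposition 2.4: L^{Ch(D_A)} presents D_A) A word w over Σ of length k ≥ 1 is D_A-admissible if and only if w is the label sequence of some path of length k in the Cantor horizon λ-graph system L^{Ch(D_A)}. Equivalently, w is D_A-admissible if and only if there exists x ∈ X_{Λ_A} such that for every m ≥ 1 the word w β_{x₁}β_{x₂}⋯β_{x_m} is D_A-admissible. -/
open scoped BigOperators

/-- A word over `{1,…,N}` is `Λ_A`-admissible if consecutive letters obey `A`. -/
def MarkovAdm {N : ℕ} (A : Fin N → Fin N → Bool) (w : List (Fin N)) : Prop :=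
  w.Chain' fun i j => A i j = true

/-- The one-sided topological Markov shift space `X_{Λ_A}`. -/
def XMarkov {N : ℕ} (A : Fin N → Fin N → Bool) : Type :=
  {x : ℕ → Fin N // ∀ n, A (x n) (x (n + 1)) = true}

/-- Prepend a symbol to a one-sided sequence. -/
def consSeq {N : ℕ} (i : Fin N) (x : ℕ → Fin N) : ℕ → Fin N
  | 0 => i
  | n + 1 => x n

/-- The partial map `τ_i` (creation: `x ↦ ix` when `A(i,x₁)=1`), i.e. `φ(β_i)`. -/
def tauBeta {N : ℕ} (A : Fin N → Fin N → Bool) (i : Fin N) (x : XMarkov A) :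
    Option (XMarkov A) :=
  if h : A i (x.1 0) = true then
    some ⟨consSeq i x.1, by
      intro n
      cases n with
      | zero => simpa [consSeq] using h
      | succ m => simpa [consSeq] using x.2 m⟩
  else none

/-- The partial map `τ_i⁻¹` (deletes the first symbol when it equals `i`), i.e. `φ(α_i)`. -/
def tauAlpha {N : ℕ} (A : Fin N → Fin N → Bool) (i : Fin N) (x : XMarkov A) :
    Option (XMarkov A) :=
  if x.1 0 = i then some ⟨fun n => x.1 (n + 1), fun n => x.2 (n + 1)⟩ else none

/-- The alphabet `Σ`: `Sum.inl i = α_i`, `Sum.inr i = β_i`. -/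
abbrev DyckSym (N : ℕ) := Fin N ⊕ Fin N

/-- `φ(α_i) = τ_i⁻¹`, `φ(β_i) = τ_i`. -/
def phiMap {N : ℕ} (A : Fin N → Fin N → Bool) :
    DyckSym N → XMarkov A → Option (XMarkov A)
  | Sum.inl i => tauAlpha A i
  | Sum.inr i => tauBeta A i

/-- The composite partial map `φ(γ₁)∘⋯∘φ(γ_n)` (rightmost applied first) applied to `x`. -/
def applyWord {N : ℕ} (A : Fin N → Fin N → Bool) (w : List (DyckSym N))
    (x : XMarkov A) : Option (XMarkov A) :=
  w.foldr (fun γ o => o.bind (phiMap A γ)) (some x)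

/-- A word over `Σ` is `D_A`-admissible if the composite partial map has nonempty domain. -/
def DAdm {N : ℕ} (A : Fin N → Fin N → Bool) (w : List (DyckSym N)) : Prop :=
  ∃ x : XMarkov A, (applyWord A w x).isSome

/-- Labeled edges of the Cantor horizon λ-graph system `L^{Ch(D_A)}`: vertices at
level `l` are the `Λ_A`-admissible words of length `l` (`[]` is the level-0 vertex `∅`),
and `LEdge A u v γ` says there is an edge labeled `γ` from `u` to `v`.
An `α_j`-edge goes from `μ₁⋯μ_l` to `μ₀μ₁⋯μ_l` exactly when `μ₀ = j`; a `β_j`-edge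
goes from `jν₁⋯ν_{l-1}` to `ν₁⋯ν_{l+1}` (for `l = 0,1` from `∅` to `(i)` with
`A(j,i) = 1`, resp. from `(j)` to `ν₁ν₂` with `A(j,ν₁) = 1`). -/
def LEdge {N : ℕ} (A : Fin N → Fin N → Bool) (u v : List (Fin N)) :
    DyckSym N → Prop
  | Sum.inl j => MarkovAdm A u ∧ MarkovAdm A v ∧ v = j :: u
  | Sum.inr j =>
      MarkovAdm A u ∧ MarkovAdm A v ∧ v.length = u.length + 1 ∧
      (∀ h, u.head? = some h → h = j) ∧
      u.tail = v.take (u.length - 1) ∧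
      ∃ h, v.head? = some h ∧ A j h = true

/-- `RPathTo A w v` : the *reversed* label list `w` (last edge first) is the label
sequence of a path in `L^{Ch(D_A)}` ending at the vertex `v`. -/
def RPathTo {N : ℕ} (A : Fin N → Fin N → Bool) :
    List (DyckSym N) → List (Fin N) → Prop
  | [], v => MarkovAdm A v
  | γ :: w, v => ∃ u, LEdge A u v γ ∧ RPathTo A w u

section

variable {N : ℕ} {A : Fin N → Fin N → Bool}

/-- The one-sided shift iterated `m` times. -/
def XMarkov.shift (m : ℕ) (x : XMarkov A) : XMarkov A :=
  ⟨fun n => x.1 (n + m), fun n => by simpa [Nat.add_right_comm] using x.2 (n + m)⟩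

/-- The word formed by the first `l` symbols of `x`. -/
def seqPrefix (x : ℕ → Fin N) (l : ℕ) : List (Fin N) := (List.range l).map x

@[simp] lemma length_seqPrefix (x : ℕ → Fin N) (l : ℕ) : (seqPrefix x l).length = l := by
  simp [seqPrefix]

lemma seqPrefix_succ (x : ℕ → Fin N) (l : ℕ) :
    seqPrefix x (l + 1) = x 0 :: seqPrefix (fun n => x (n + 1)) l := by
  simp [seqPrefix, List.range_succ_eq_map, Function.comp_def]

lemma take_seqPrefix (x : ℕ → Fin N) {k l : ℕ} (h : k ≤ l) :
    (seqPrefix x l).take k = seqPrefix x k := by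
  simp [seqPrefix, ← List.map_take, List.take_range, h]

lemma markovAdm_seqPrefix (x : XMarkov A) (l : ℕ) : MarkovAdm A (seqPrefix x.1 l) := by
  refine List.isChain_iff_getElem.2 ?_
  intro i hi
  simpa [seqPrefix] using x.2 i

lemma phiMap_inl_eq_some {j : Fin N} {x y : XMarkov A} :
    phiMap A (Sum.inl j) x = some y ↔ x.1 = consSeq j y.1 := by
  simp only [phiMap, tauAlpha, Option.ite_none_right_eq_some]
  constructor
  · rintro ⟨h, hy⟩
    obtain rfl := Option.some.inj hy
    funext n
    cases n with
    | zero => exact h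
    | succ n => rfl
  · intro h
    refine ⟨by simp [h, consSeq], congrArg some (Subtype.ext ?_)⟩
    funext n
    simp [h, consSeq]

lemma phiMap_inr_eq_some {j : Fin N} {x y : XMarkov A} :
    phiMap A (Sum.inr j) x = some y ↔ A j (x.1 0) = true ∧ y.1 = consSeq j x.1 := by
  simp only [phiMap, tauBeta, Option.dite_none_right_eq_some]
  constructor
  · rintro ⟨h, hy⟩
    obtain rfl := Option.some.inj hy
    exact ⟨h, rfl⟩
  · rintro ⟨h, hy⟩
    exact ⟨h, congrArg some (Subtype.ext hy.symm)⟩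

lemma seqPrefix_consSeq_succ (j : Fin N) (x : ℕ → Fin N) (l : ℕ) :
    seqPrefix (consSeq j x) (l + 1) = j :: seqPrefix x l :=
  seqPrefix_succ _ _

lemma applyWord_append (u v : List (DyckSym N)) (x : XMarkov A) :
    applyWord A (u ++ v) x = (applyWord A v x).bind (applyWord A u) := by
  induction u with
  | nil => exact (Option.bind_fun_some _).symm
  | cons γ u ih =>
    change (applyWord A (u ++ v) x).bind (phiMap A γ) = _
    rw [ih, Option.bind_assoc]
    rfl

lemma applyWord_singleton (γ : DyckSym N) (x : XMarkov A) :
    applyWord A [γ] x = phiMap A γ x := rfl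

/-- Applying a partial map `φ(γ)` to `x` gives an edge between prefixes. -/
lemma lEdge_seqPrefix {γ : DyckSym N} {x y : XMarkov A} (h : phiMap A γ x = some y) (l : ℕ) :
    LEdge A (seqPrefix y.1 l) (seqPrefix x.1 (l + 1)) γ := by
  have hy := markovAdm_seqPrefix y l
  have hx := markovAdm_seqPrefix x (l + 1)
  cases γ with
  | inl j =>
    rw [phiMap_inl_eq_some] at h
    exact ⟨hy, hx, by rw [h, seqPrefix_consSeq_succ]⟩
  | inr j =>
    obtain ⟨hA, h⟩ := phiMap_inr_eq_some.1 h
    refine ⟨hy, hx, by simp, ?_, ?_, x.1 0, by simp [seqPrefix_succ], hA⟩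
    · cases l with
      | zero => simp [seqPrefix]
      | succ l => simp [h, seqPrefix_consSeq_succ]
    · cases l with
      | zero => simp [seqPrefix]
      | succ l =>
        rw [h, seqPrefix_consSeq_succ, List.length_cons, length_seqPrefix, Nat.add_sub_cancel,
          take_seqPrefix _ (by lia), List.tail_cons]

/-- If an edge labeled `γ` ends at a prefix of `x`, then `φ(γ)` is defined at `x` and the edge
starts at a prefix of the image. -/
lemma LEdge.exists_phiMap_eq_some {γ : DyckSym N} {x : XMarkov A} {u : List (Fin N)} {l : ℕ}
    (h : LEdge A u (seqPrefix x.1 l) γ) :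
    ∃ y : XMarkov A, phiMap A γ x = some y ∧ u = seqPrefix y.1 u.length := by
  cases γ with
  | inl j =>
    obtain ⟨-, -, h⟩ := h
    obtain rfl : l = u.length + 1 := by simpa using congrArg List.length h
    rw [seqPrefix_succ, List.cons.injEq] at h
    refine ⟨x.shift 1, phiMap_inl_eq_some.2 ?_, h.2.symm⟩
    funext n
    cases n with
    | zero => exact h.1
    | succ n => rfl
  | inr j =>
    obtain ⟨-, -, hl, hhead, htail, a, ha, hA⟩ := h
    obtain rfl : l = u.length + 1 := by simpa using hl
    obtain rfl : x.1 0 = a := by simpa [seqPrefix_succ] using ha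
    have hdef : phiMap A (Sum.inr j) x = some _ := dif_pos hA
    refine ⟨_, hdef, ?_⟩
    cases u with
    | nil => rfl
    | cons b u =>
      obtain rfl := hhead b rfl
      rw [List.length_cons, seqPrefix_consSeq_succ]
      rw [List.tail_cons, List.length_cons, Nat.add_sub_cancel,
        take_seqPrefix _ (by lia)] at htail
      rw [← htail]

lemma rPathTo_seqPrefix (w : List (DyckSym N)) (k : ℕ) (x : XMarkov A)
    (h : (applyWord A w.reverse x).isSome) : RPathTo A w (seqPrefix x.1 (k + w.length)) := by
  induction w generalizing x with
  | nil => exact markovAdm_seqPrefix x _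
  | cons γ w ih =>
    rw [List.reverse_cons, applyWord_append, applyWord_singleton] at h
    cases hy : phiMap A γ x with
    | none => simp [hy] at h
    | some y =>
      rw [hy] at h
      exact ⟨_, lEdge_seqPrefix hy _, ih y h⟩

lemma RPathTo.isSome_applyWord {w : List (DyckSym N)} {x : XMarkov A} {l : ℕ}
    (h : RPathTo A w (seqPrefix x.1 l)) : (applyWord A w.reverse x).isSome := by
  induction w generalizing x l with
  | nil => rfl
  | cons γ w ih =>
    obtain ⟨u, he, hu⟩ := h
    obtain ⟨y, hy, hyu⟩ := he.exists_phiMap_eq_some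
    rw [List.reverse_cons, applyWord_append, applyWord_singleton, hy]
    rw [hyu] at hu
    exact ih hu

lemma RPathTo.markovAdm {w : List (DyckSym N)} {v : List (Fin N)} (h : RPathTo A w v) :
    MarkovAdm A v := by
  rcases w with _ | ⟨j | j, w⟩
  · exact h
  all_goals
    obtain ⟨u, he, -⟩ := h
    exact he.2.1

lemma exists_seqPrefix_cons_eq (hrow : ∀ i, ∃ j, A i j = true) (i : Fin N) (v : List (Fin N))
    (h : MarkovAdm A (i :: v)) :
    ∃ x : XMarkov A, i :: v = seqPrefix x.1 (v.length + 1) := by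
  induction v generalizing i with
  | nil =>
    choose f hf using hrow
    refine ⟨⟨fun n => f^[n] i, fun n => ?_⟩, rfl⟩
    simpa only [Function.iterate_succ_apply'] using hf (f^[n] i)
  | cons b v ih =>
    obtain ⟨hib, hv⟩ := List.isChain_cons_cons.1 h
    obtain ⟨x, hx⟩ := ih b hv
    have hb : b = x.1 0 := by
      rw [seqPrefix_succ] at hx
      exact (List.cons.inj hx).1
    refine ⟨⟨consSeq i x.1, fun n => ?_⟩, ?_⟩
    · cases n with
      | zero => simpa [consSeq, ← hb] using hib
      | succ n => exact x.2 n
    · rw [List.length_cons, seqPrefix_consSeq_succ, hx]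

lemma exists_seqPrefix_eq [NeZero N] (hrow : ∀ i, ∃ j, A i j = true) {v : List (Fin N)}
    (h : MarkovAdm A v) : ∃ x : XMarkov A, v = seqPrefix x.1 v.length := by
  cases v with
  | nil =>
    obtain ⟨x, -⟩ := exists_seqPrefix_cons_eq hrow 0 [] (List.isChain_singleton _)
    exact ⟨x, rfl⟩
  | cons i v => exact exists_seqPrefix_cons_eq hrow i v h

lemma applyWord_map_inr_shift (x : XMarkov A) (m : ℕ) :
    applyWord A ((List.range m).map fun k => Sum.inr (x.1 k)) (x.shift m) = some x := by
  induction m with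
  | zero => rfl
  | succ m ih =>
    have hstep : phiMap A (Sum.inr (x.1 m)) (x.shift (m + 1)) = some (x.shift m) := by
      refine phiMap_inr_eq_some.2 ⟨by simpa [XMarkov.shift] using x.2 m, ?_⟩
      funext n
      cases n with
      | zero => simp [XMarkov.shift, consSeq]
      | succ n => simp [XMarkov.shift, consSeq, Nat.add_right_comm, Nat.add_assoc]
    rw [List.range_succ, List.map_append, applyWord_append, List.map_singleton,
      applyWord_singleton, hstep]
    exact ih

lemma DAdm.of_append {u v : List (DyckSym N)} (h : DAdm A (u ++ v)) : DAdm A u := by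
  obtain ⟨x, hx⟩ := h
  rw [applyWord_append] at hx
  cases hy : applyWord A v x with
  | none => simp [hy] at hx
  | some y => exact ⟨y, by simpa [hy] using hx⟩

end

/-- Proposition 2.4: a nonempty word `w` over `Σ` is
`D_A`-admissible iff it is the label sequence of a path in `L^{Ch(D_A)}`,
and equivalently iff there is `x ∈ X_{Λ_A}` with `w β_{x₁}⋯β_{x_m}`
`D_A`-admissible for every `m ≥ 1`. -/
theorem stmt6 {N : ℕ} (hN : 2 ≤ N) (A : Fin N → Fin N → Bool)
    (hrow : ∀ i, ∃ j, A i j = true) (hcol : ∀ j, ∃ i, A i j = true)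
    (w : List (DyckSym N)) (hw : w ≠ []) :
    (DAdm A w ↔ ∃ v : List (Fin N), RPathTo A w.reverse v) ∧
    (DAdm A w ↔ ∃ x : XMarkov A, ∀ m : ℕ, 1 ≤ m →
      DAdm A (w ++ (List.range m).map fun k => Sum.inr (x.1 k))) := by
  have : NeZero N := ⟨by lia⟩
  refine ⟨⟨?_, ?_⟩, ?_, ?_⟩
  · rintro ⟨x, hx⟩
    exact ⟨_, rPathTo_seqPrefix w.reverse 0 x (by rwa [List.reverse_reverse])⟩
  · rintro ⟨v, hv⟩
    obtain ⟨x, hx⟩ := exists_seqPrefix_eq hrow hv.markovAdm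
    rw [hx] at hv
    exact ⟨x, by simpa using hv.isSome_applyWord⟩
  · rintro ⟨x, hx⟩
    refine ⟨x, fun m _ => ⟨x.shift m, ?_⟩⟩
    rw [applyWord_append, applyWord_map_inr_shift]
    exact hx
  · rintro ⟨x, hx⟩
    exact (hx 1 le_rfl).of_append
end

section
/- (Abstract side of Lemma 4.1) Under the relations (1.1)–(1.4), for every Λ_A-admissible word μ = μ₁⋯μ_l with l ≥ 2: Σ_{j=1}^N S_j* E_μ S_j = Σ_{j=1}^N A(j,μ₁) E_{jμ₁⋯μ_l}, and Σ_{j=1}^N T_j* E_μ T_j = A(μ₁,μ₂) E_{μ₂⋯μ_l}. (These compute the endomorphisms λ_{Σ⁻}(a) = Σ_j S_j* a S_j and λ_{Σ⁺}(a) = Σ_j T_j* a T_j on the projections E_μ.) -/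
open scoped BigOperators

/-- `Eproj S [μ₁,…,μ_k] = S_{μ₁}*⋯S_{μ_k}* S_{μ_k}⋯S_{μ₁}` (and `Eproj S [] = 1`). -/
def Eproj {N : ℕ} {B : Type*} [Ring B] [StarRing B] (S : Fin N → B) :
    List (Fin N) → B
  | [] => 1
  | i :: w => star (S i) * Eproj S w * S i

/-- Star projections of a C*-algebra that sum to `1` are mutually orthogonal. -/
theorem IsStarProjection.mul_eq_zero_of_sum_eq_one {ι B : Type*} [Fintype ι] [CStarAlgebra B]
    {p : ι → B} (hp : ∀ i, IsStarProjection (p i)) (hsum : ∑ i, p i = 1) {i j : ι} (hij : i ≠ j) :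
    p i * p j = 0 := by
  classical
  let _ := CStarAlgebra.spectralOrder B
  have _ := CStarAlgebra.spectralOrderedRing B
  have hterm (k : ι) : star (p k * p j) * (p k * p j) = p j * p k * p j := by
    rw [star_mul, (hp j).isSelfAdjoint.star_eq, (hp k).isSelfAdjoint.star_eq,
      mul_assoc, ← mul_assoc (p k), (hp k).isIdempotentElem.eq, mul_assoc]
  have hj : p j * p j = p j := (hp j).isIdempotentElem.eq
  have hall : ∑ k, star (p k * p j) * (p k * p j) = p j := by
    simp_rw [hterm]
    rw [← Finset.sum_mul, ← Finset.mul_sum, hsum, mul_one, hj]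
  have hzero : ∑ k ∈ Finset.univ.erase j, star (p k * p j) * (p k * p j) = 0 := by
    rw [← Finset.add_sum_erase _ _ (Finset.mem_univ j), hterm j, hj, hj] at hall
    exact left_eq_add.mp hall.symm
  rw [Finset.sum_eq_zero_iff_of_nonneg fun k _ => star_mul_self_nonneg _] at hzero
  exact (CStarRing.star_mul_self_eq_zero_iff _).mp
    (hzero i (Finset.mem_erase.mpr ⟨hij, Finset.mem_univ i⟩))

/-- The range projection of a partial isometry. -/
theorem isStarProjection_mul_star_self {B : Type*} [Ring B] [StarRing B] {v : B}
    (hv : v * star v * v = v) : IsStarProjection (v * star v) where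
  isIdempotentElem := by
    rw [IsIdempotentElem, ← mul_assoc, hv]
  isSelfAdjoint := .mul_star_self v

theorem star_mul_self_mul_star {B : Type*} [Ring B] [StarRing B] {v : B}
    (hv : v * star v * v = v) : star v * v * star v = star v := by
  simpa [mul_assoc] using congrArg star hv

/-- Partial isometries with orthogonal range projections. -/
theorem star_mul_eq_zero_of_range_orthogonal {B : Type*} [Ring B] [StarRing B] {v w : B}
    (hv : v * star v * v = v) (hw : w * star w * w = w)
    (h : v * star v * (w * star w) = 0) : star v * w = 0 := by
  calc star v * w = star v * v * star v * (w * star w * w) := by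
        rw [star_mul_self_mul_star hv, hw]
    _ = star v * (v * star v * (w * star w)) * w := by simp only [mul_assoc]
    _ = 0 := by rw [h, mul_zero, zero_mul]

/-- Partial isometries whose range projections sum to `1` satisfy `v i* v j = 0` for `i ≠ j`. -/
theorem star_mul_eq_zero_of_sum_range_eq_one {ι B : Type*} [Fintype ι] [CStarAlgebra B]
    {v : ι → B} (hv : ∀ i, v i * star (v i) * v i = v i) (hsum : ∑ i, v i * star (v i) = 1)
    {i j : ι} (hij : i ≠ j) : star (v i) * v j = 0 :=
  star_mul_eq_zero_of_range_orthogonal (hv i) (hv j)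
    (IsStarProjection.mul_eq_zero_of_sum_eq_one
      (fun i => isStarProjection_mul_star_self (hv i)) hsum hij)

/-- abstract side of Lemma 4.1: under the relations (1.1)–(1.4),
for an admissible word `μ = μ₁μ₂⋯μ_l` (`l ≥ 2`):
`Σ_j S_j* E_μ S_j = Σ_j A(j,μ₁) E_{jμ}` and `Σ_j T_j* E_μ T_j = A(μ₁,μ₂) E_{μ₂⋯μ_l}`. -/
theorem stmt16 {N : ℕ} (hN : 2 ≤ N) (A : Fin N → Fin N → Bool)
    (hrow : ∀ i, ∃ j, A i j = true) (hcol : ∀ j, ∃ i, A i j = true)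
    {B : Type*} [CStarAlgebra B] (S T : Fin N → B)
    (hSpi : ∀ i, S i * star (S i) * S i = S i)
    (hTpi : ∀ i, T i * star (T i) * T i = T i)
    (h11 : ∑ j, (S j * star (S j) + T j * star (T j)) = 1)
    (h12 : ∑ j, star (S j) * S j = 1)
    (h13 : ∀ i, star (T i) * T i = ∑ j, if A i j then star (S j) * S j else 0)
    (h14 : ∀ (i : Fin N) (w : List (Fin N)), w ≠ [] →
      Eproj S (i :: w) =
        (∑ j, if A j i then
          S j * star (S j) * Eproj S (i :: w) * (S j * star (S j)) else 0)
        + T i * Eproj S w * star (T i))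
    (μ₁ μ₂ : Fin N) (w : List (Fin N)) (hadm : MarkovAdm A (μ₁ :: μ₂ :: w)) :
    (∑ j, star (S j) * Eproj S (μ₁ :: μ₂ :: w) * S j =
      ∑ j, if A j μ₁ then Eproj S (j :: μ₁ :: μ₂ :: w) else 0) ∧
    (∑ j, star (T j) * Eproj S (μ₁ :: μ₂ :: w) * T j =
      if A μ₁ μ₂ then Eproj S (μ₂ :: w) else 0) := by
  have hpi : ∀ k, Sum.elim S T k * star (Sum.elim S T k) * Sum.elim S T k = Sum.elim S T k := by
    rintro (i | i)
    exacts [hSpi i, hTpi i]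
  have hsum : ∑ k, Sum.elim S T k * star (Sum.elim S T k) = 1 := by
    rw [Fintype.sum_sum_type, ← h11, Finset.sum_add_distrib]
    rfl
  have hSS {i j : Fin N} (h : i ≠ j) : star (S i) * S j = 0 :=
    star_mul_eq_zero_of_sum_range_eq_one hpi hsum (i := .inl i) (j := .inl j) (by simpa using h)
  have hTT {i j : Fin N} (h : i ≠ j) : star (T i) * T j = 0 :=
    star_mul_eq_zero_of_sum_range_eq_one hpi hsum (i := .inr i) (j := .inr j) (by simpa using h)
  have hST (i j : Fin N) : star (S i) * T j = 0 :=
    star_mul_eq_zero_of_sum_range_eq_one hpi hsum (i := .inl i) (j := .inr j) (by simp)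
  have hTS (i j : Fin N) : star (T i) * S j = 0 :=
    star_mul_eq_zero_of_sum_range_eq_one hpi hsum (i := .inr i) (j := .inl j) (by simp)
  have hSS' {i j : Fin N} (h : i ≠ j) : S i * star (S j) = 0 := by
    simpa using star_mul_eq_zero_of_sum_range_eq_one (v := fun i => star (S i))
      (fun i => by simpa using star_mul_self_mul_star (hSpi i)) (by simpa using h12) h
  have hE := h14 μ₁ (μ₂ :: w) (List.cons_ne_nil _ _)
  constructor
  · refine Finset.sum_congr rfl fun m _ => ?_
    set E := Eproj S (μ₁ :: μ₂ :: w) with hEdef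
    have hm : star (S m) * S m * star (S m) = star (S m) := star_mul_self_mul_star (hSpi m)
    have hterm : ∀ j, j ≠ m → star (S m) * (if A j μ₁ then
        S j * star (S j) * E * (S j * star (S j)) else 0) * S m = 0 := fun j hj => by
      split_ifs
      · simp only [← mul_assoc, hSS hj.symm, zero_mul]
      · simp
    calc star (S m) * E * S m
        = ∑ j, star (S m) * (if A j μ₁ then
            S j * star (S j) * E * (S j * star (S j)) else 0) * S m := by
          conv_lhs => rw [hE]
          rw [mul_add, add_mul, Finset.mul_sum, Finset.sum_mul]
          simp only [← mul_assoc, hST, zero_mul, add_zero]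
      _ = star (S m) * (if A m μ₁ then
            S m * star (S m) * E * (S m * star (S m)) else 0) * S m :=
          Fintype.sum_eq_single m hterm
      _ = if A m μ₁ then Eproj S (m :: μ₁ :: μ₂ :: w) else 0 := by
          split_ifs
          · change _ = star (S m) * E * S m
            calc _ = star (S m) * S m * star (S m) * E * (S m * star (S m) * S m) := by
                  simp only [mul_assoc]
              _ = _ := by rw [hm, hSpi]
          · simp
  · set F := Eproj S (μ₂ :: w) with hF
    have hTj (j : Fin N) : star (T j) * Eproj S (μ₁ :: μ₂ :: w) * T j =
        star (T j) * T μ₁ * F * (star (T μ₁) * T j) := by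
      rw [hE, mul_add, add_mul, Finset.mul_sum, Finset.sum_mul,
        Finset.sum_eq_zero, zero_add]
      · simp only [mul_assoc]
      · intro k _
        split_ifs
        · simp only [← mul_assoc, hTS, zero_mul]
        · simp
    have hleft : star (T μ₁) * T μ₁ * F = if A μ₁ μ₂ then F else 0 := by
      rw [h13, Finset.sum_mul, Fintype.sum_eq_single μ₂]
      · split_ifs
        · simp only [hF, Eproj, ← mul_assoc, star_mul_self_mul_star (hSpi μ₂)]
        · simp
      · intro j hj
        split_ifs
        · rw [hF, Eproj, mul_assoc, ← mul_assoc (S j), ← mul_assoc (S j), hSS' hj]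
          simp
        · simp
    have hright : F * (star (T μ₁) * T μ₁) = if A μ₁ μ₂ then F else 0 := by
      rw [h13, Finset.mul_sum, Fintype.sum_eq_single μ₂]
      · split_ifs
        · rw [hF, Eproj, mul_assoc, ← mul_assoc (S μ₂), hSpi]
        · simp
      · intro j hj
        split_ifs
        · rw [hF, Eproj, mul_assoc, ← mul_assoc (S μ₂), hSS' hj.symm]
          simp
        · simp
    rw [Fintype.sum_eq_single μ₁ fun j hj => by rw [hTj, hTT hj]; simp, hTj, hleft, ite_mul,
      zero_mul, hright]
    split_ifs <;> rfl
end
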